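/- arXiv:2104.00300 — 2 statements merged into one kernel-verified Lean document; each statement's English description precedes it below -/
import Mathlib

section
/- Let (U, σ) be a catalysis in canonical form: U a unitary on ℂ^{d_A} ⊗ ℂ^{d_B} and σ a density matrix on ℂ^{d_B} with Tr_A(U(ρ ⊗ σ)U†) = σ for every density matrix ρ on ℂ^{d_A}. Write the spectral decomposition σ = ∑_{i=1}^n λ_i Π_i with distinct eigenvalues λ_i and multiplicities r_i = Tr Π_i. Let r be any positive integer, let Û denote the unitary on ℂ^r ⊗ ℂ^{d_A} ⊗ ℂ^{d_B} acting as the identity on the first factor and as U on the last two factors, and for a density matrix ρ on ℂ^r ⊗ ℂ^{d_A} set ω = Tr_B(Û(ρ ⊗ σ)Û†). Then the min-entropy production is bounded by the catalytic min-entropy of σ: S_min(ω) − S_min(ρ) ≤ −log₂ max_i (λ_i / r_i). -/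
open scoped Matrix Kronecker BigOperators Classical ComplexOrder

/-- A density matrix: positive semidefinite with unit trace. -/
noncomputable def IsDensity {n : Type*} [Fintype n] (ρ : Matrix n n ℂ) : Prop :=
  ρ.PosSemidef ∧ ρ.trace = 1

/-- A unitary matrix. -/
noncomputable def IsUnitary {n : Type*} [Fintype n] [DecidableEq n] (U : Matrix n n ℂ) : Prop :=
  U * Uᴴ = 1 ∧ Uᴴ * U = 1

/-- Partial trace over the first tensor factor. -/
noncomputable def trFst {α β : Type*} [Fintype α] (M : Matrix (α × β) (α × β) ℂ) : Matrix β β ℂ :=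
  Matrix.of fun k l => ∑ i, M (i, k) (i, l)

/-- Partial trace over the second tensor factor. -/
noncomputable def trSnd {α β : Type*} [Fintype β] (M : Matrix (α × β) (α × β) ℂ) : Matrix α α ℂ :=
  Matrix.of fun i j => ∑ k, M (i, k) (j, k)

/-- Partial trace over the third factor of a tripartite system. -/
noncomputable def trThird {α β γ : Type*} [Fintype γ] (M : Matrix (α × β × γ) (α × β × γ) ℂ) :
    Matrix (α × β) (α × β) ℂ :=
  Matrix.of fun p q => ∑ k, M (p.1, p.2, k) (q.1, q.2, k)

/-- von Neumann entropy (base-2), with the convention `0 log 0 = 0`. -/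
noncomputable def vnEntropy {n : Type*} [Fintype n] [DecidableEq n] (ρ : Matrix n n ℂ) : ℝ :=
  if h : ρ.IsHermitian then -∑ i, h.eigenvalues i * Real.logb 2 (h.eigenvalues i) else 0

/-- Largest eigenvalue of a (Hermitian) matrix. -/
noncomputable def maxEig {n : Type*} [Fintype n] [DecidableEq n] (ρ : Matrix n n ℂ) : ℝ :=
  if h : ρ.IsHermitian then ⨆ i, h.eigenvalues i else 0

/-- Min-entropy of a density matrix. -/
noncomputable def minEntropy {n : Type*} [Fintype n] [DecidableEq n] (ρ : Matrix n n ℂ) : ℝ :=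
  -Real.logb 2 (maxEig ρ)

/-- Rényi entropy of order `α` (base 2). -/
noncomputable def renyiEntropy {n : Type*} [Fintype n] [DecidableEq n] (α : ℝ)
    (ρ : Matrix n n ℂ) : ℝ :=
  if h : ρ.IsHermitian then (1 - α)⁻¹ * Real.logb 2 (∑ i, h.eigenvalues i ^ α) else 0

/-- Partial transpose over the first tensor factor. -/
noncomputable def ptFst {α β : Type*} (U : Matrix (α × β) (α × β) ℂ) : Matrix (α × β) (α × β) ℂ :=
  Matrix.of fun p q => U (q.1, p.2) (p.1, q.2)

/-- Swap the two parties of a bipartite matrix. -/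
noncomputable def swapParties {α β : Type*} (U : Matrix (α × β) (α × β) ℂ) : Matrix (β × α) (β × α) ℂ :=
  Matrix.of fun p q => U (p.2, p.1) (q.2, q.1)

/-- `U` is compatible with the catalyst `σ`: there is a unitary `V` on `B` such that
`Tr_A (U (ρ ⊗ σ) U†) = V σ V†` for every density matrix `ρ` on `A`. -/
noncomputable def Compatible {dA dB : ℕ} (U : Matrix (Fin dA × Fin dB) (Fin dA × Fin dB) ℂ)
    (σ : Matrix (Fin dB) (Fin dB) ℂ) : Prop :=
  ∃ V : Matrix (Fin dB) (Fin dB) ℂ, IsUnitary V ∧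
    ∀ ρ : Matrix (Fin dA) (Fin dA) ℂ, IsDensity ρ →
      trFst (U * (ρ ⊗ₖ σ) * Uᴴ) = V * σ * Vᴴ

/-- The unitary `1_m ⊗ U` on `ℂ^m ⊗ ℂ^{dA} ⊗ ℂ^{dB}`, indexed as `(Fin m × Fin dA) × Fin dB`. -/
noncomputable def extUnitary {m dA dB : ℕ} (U : Matrix (Fin dA × Fin dB) (Fin dA × Fin dB) ℂ) :
    Matrix ((Fin m × Fin dA) × Fin dB) ((Fin m × Fin dA) × Fin dB) ℂ :=
  Matrix.of fun p q => if p.1.1 = q.1.1 then U (p.1.2, p.2) (q.1.2, q.2) else 0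

section helpers
open Matrix

lemma maxEig_sub_psd {n : Type*} [Fintype n] [DecidableEq n] (A : Matrix n n ℂ)
    (hA : A.IsHermitian) : (((maxEig A : ℝ) : ℂ) • (1 : Matrix n n ℂ) - A).PosSemidef := by
  have hle : ∀ i, hA.eigenvalues i ≤ maxEig A := by
    intro i
    unfold maxEig
    rw [dif_pos hA]
    exact le_ciSup (Set.finite_range _).bddAbove i
  set V := (hA.eigenvectorUnitary : Matrix n n ℂ) with hV
  have hVV : V * Vᴴ = 1 := by
    have := hA.eigenvectorUnitary.2
    exact (Unitary.mem_iff.mp this).2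
  have hs : A = V * diagonal (fun i => ((hA.eigenvalues i : ℝ) : ℂ)) * Vᴴ := by
    have := hA.spectral_theorem
    rw [Unitary.conjStarAlgAut_apply] at this
    exact this
  have h2 : ((maxEig A : ℝ) : ℂ) • (1 : Matrix n n ℂ) - A
      = V * diagonal (fun i => ((maxEig A - hA.eigenvalues i : ℝ) : ℂ)) * Vᴴ := by
    have : diagonal (fun i => ((maxEig A - hA.eigenvalues i : ℝ) : ℂ))
        = ((maxEig A : ℝ) : ℂ) • (1 : Matrix n n ℂ)
          - diagonal (fun i => ((hA.eigenvalues i : ℝ) : ℂ)) := by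
      ext i j
      by_cases h : i = j <;> simp [h]
    rw [this, Matrix.mul_sub, Matrix.sub_mul, ← hs]
    simp [hVV]
  rw [h2]
  apply PosSemidef.mul_mul_conjTranspose_same
  rw [posSemidef_diagonal_iff]
  intro i
  have := hle i
  exact_mod_cast sub_nonneg.mpr this

lemma maxEig_vec {n : Type*} [Fintype n] [DecidableEq n] [Nonempty n] (A : Matrix n n ℂ)
    (hA : A.IsHermitian) : ∃ ψ : Matrix n Unit ℂ, ψᴴ * ψ = 1 ∧
      A * ψ = ((maxEig A : ℝ) : ℂ) • ψ := by
  obtain ⟨i, hi⟩ := exists_eq_ciSup_of_finite (f := hA.eigenvalues)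
  have hi' : hA.eigenvalues i = maxEig A := by
    unfold maxEig
    rw [dif_pos hA, hi]
  refine ⟨Matrix.of fun x _ => hA.eigenvectorBasis i x, ?_, ?_⟩
  · ext a b
    have h := hA.eigenvectorBasis.orthonormal.1 i
    have h1 : inner ℂ (hA.eigenvectorBasis i) (hA.eigenvectorBasis i) = (1 : ℂ) := by
      rw [inner_self_eq_norm_sq_to_K, h]; simp
    rw [PiLp.inner_apply] at h1
    simp only [mul_apply, conjTranspose_apply, of_apply, one_apply, if_true]
    rw [← h1]
    apply Finset.sum_congr rfl
    intro x _
    rw [RCLike.inner_apply, mul_comm]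
    rfl
  · ext x a
    have h := congrFun (hA.mulVec_eigenvectorBasis i) x
    rw [hi'] at h
    simpa [mul_apply, mulVec, dotProduct] using h

lemma psd_sub {n : Type*} [Fintype n] [DecidableEq n] (A : Matrix n n ℂ)
    (hA : A.PosSemidef) (c : ℝ) (ψ : Matrix n Unit ℂ) (h1 : ψᴴ * ψ = 1)
    (h2 : A * ψ = (c : ℂ) • ψ) : (A - (c : ℂ) • (ψ * ψᴴ)).PosSemidef := by
  have h3 : ψᴴ * A = (c : ℂ) • ψᴴ := by
    have := congrArg conjTranspose h2
    rw [conjTranspose_mul, conjTranspose_smul, hA.1.eq] at this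
    simpa using this
  have h4 := hA.mul_mul_conjTranspose_same (1 - ψ * ψᴴ)
  have : (1 - ψ * ψᴴ) * A * (1 - ψ * ψᴴ)ᴴ = A - (c : ℂ) • (ψ * ψᴴ) := by
    have e1 : ψ * ψᴴ * A = (c : ℂ) • (ψ * ψᴴ) := by
      rw [Matrix.mul_assoc, h3, Matrix.mul_smul]
    have e2 : A * (ψ * ψᴴ) = (c : ℂ) • (ψ * ψᴴ) := by
      rw [← Matrix.mul_assoc, h2, Matrix.smul_mul]
    have e3 : ψ * ψᴴ * (ψ * ψᴴ) = ψ * ψᴴ := by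
      rw [Matrix.mul_assoc, ← Matrix.mul_assoc ψᴴ, h1, Matrix.one_mul]
    rw [conjTranspose_sub, conjTranspose_one, conjTranspose_mul, conjTranspose_conjTranspose,
      Matrix.sub_mul, Matrix.mul_sub, e1, Matrix.mul_one, Matrix.one_mul, Matrix.sub_mul,
      Matrix.smul_mul, e3, e2]
    simp
  rwa [this] at h4

lemma maxEig_pos {n : Type*} [Fintype n] [DecidableEq n] (A : Matrix n n ℂ)
    (hA : IsDensity A) : 0 < maxEig A := by
  have h := (maxEig_sub_psd A hA.1.1).trace_nonneg
  rw [trace_sub, hA.2, trace_smul, trace_one] at h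
  by_contra hc
  push Not at hc
  have h' : (0 : ℝ) ≤ maxEig A * (Fintype.card n : ℝ) - 1 := by
    have : (0 : ℂ) ≤ ((maxEig A * (Fintype.card n : ℝ) - 1 : ℝ) : ℂ) := by
      simpa using h
    exact_mod_cast this
  have : maxEig A * (Fintype.card n : ℝ) ≤ 0 := mul_nonpos_of_nonpos_of_nonneg hc (by positivity)
  linarith

lemma trSnd_psd {α β : Type*} [Fintype α] [Fintype β] (M : Matrix (α × β) (α × β) ℂ)
    (h : M.PosSemidef) : (trSnd M).PosSemidef := by
  have : trSnd M = ∑ k, M.submatrix (fun i => (i, k)) (fun i => (i, k)) := by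
    ext i j
    simp [trSnd, Matrix.sum_apply]
  rw [this]
  exact posSemidef_sum _ fun k _ => h.submatrix _

lemma trSnd_sub_smul {α β : Type*} [Fintype β] (c : ℂ) (M N : Matrix (α × β) (α × β) ℂ) :
    trSnd (M - c • N) = trSnd M - c • trSnd N := by
  ext i j
  simp [trSnd, Finset.mul_sum]

lemma extUnitary_eq {m dA dB : ℕ} (U : Matrix (Fin dA × Fin dB) (Fin dA × Fin dB) ℂ) :
    (extUnitary U : Matrix ((Fin m × Fin dA) × Fin dB) ((Fin m × Fin dA) × Fin dB) ℂ)
      = ((1 : Matrix (Fin m) (Fin m) ℂ) ⊗ₖ U).submatrix (Equiv.prodAssoc _ _ _)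
        (Equiv.prodAssoc _ _ _) := by
  ext ⟨⟨a, b⟩, c⟩ ⟨⟨a', b'⟩, c'⟩
  simp [extUnitary, one_apply]

lemma ext_comm {m dA dB : ℕ} (U : Matrix (Fin dA × Fin dB) (Fin dA × Fin dB) ℂ)
    (P : Matrix (Fin dB) (Fin dB) ℂ)
    (h : ((1 : Matrix (Fin dA) (Fin dA) ℂ) ⊗ₖ P) * U * ((1 : Matrix (Fin dA) (Fin dA) ℂ) ⊗ₖ P)
      = U * ((1 : Matrix (Fin dA) (Fin dA) ℂ) ⊗ₖ P)) :
    ((1 : Matrix (Fin m × Fin dA) (Fin m × Fin dA) ℂ) ⊗ₖ P) * extUnitary U *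
        ((1 : Matrix (Fin m × Fin dA) (Fin m × Fin dA) ℂ) ⊗ₖ P)
      = extUnitary U * ((1 : Matrix (Fin m × Fin dA) (Fin m × Fin dA) ℂ) ⊗ₖ P) := by
  have hP : ((1 : Matrix (Fin m × Fin dA) (Fin m × Fin dA) ℂ) ⊗ₖ P)
      = ((1 : Matrix (Fin m) (Fin m) ℂ) ⊗ₖ ((1 : Matrix (Fin dA) (Fin dA) ℂ) ⊗ₖ P)).submatrix
        (Equiv.prodAssoc _ _ _) (Equiv.prodAssoc _ _ _) := by
    ext ⟨⟨a, b⟩, c⟩ ⟨⟨a', b'⟩, c'⟩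
    by_cases h1 : a = a' <;> by_cases h2 : b = b' <;> simp [h1, h2, one_apply]
  rw [hP, extUnitary_eq]
  simp only [submatrix_mul_equiv, ← mul_kronecker_mul, h]
  simp

lemma ext_unit {m dA dB : ℕ} (U : Matrix (Fin dA × Fin dB) (Fin dA × Fin dB) ℂ)
    (hU : Uᴴ * U = 1) :
    (extUnitary U : Matrix ((Fin m × Fin dA) × Fin dB) ((Fin m × Fin dA) × Fin dB) ℂ)ᴴ
      * extUnitary U = 1 := by
  rw [extUnitary_eq, conjTranspose_submatrix, submatrix_mul_equiv, conjTranspose_kronecker,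
    ← mul_kronecker_mul, hU]
  simp

lemma trace_one_kron {dA dB : ℕ} (M : Matrix (Fin dA × Fin dB) (Fin dA × Fin dB) ℂ)
    (σ : Matrix (Fin dB) (Fin dB) ℂ) :
    (M * ((1 : Matrix (Fin dA) (Fin dA) ℂ) ⊗ₖ σ)).trace = (trFst M * σ).trace := by
  simp only [trace, diag_apply, mul_apply, Fintype.sum_prod_type, trFst, of_apply,
    kroneckerMap_apply, one_apply, Finset.sum_mul]
  simp only [ite_mul, one_mul, zero_mul, mul_ite, mul_zero]
  rw [Finset.sum_comm]
  refine Finset.sum_congr rfl fun k _ => ?_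
  rw [Finset.sum_comm (s := Finset.univ (α := Fin dB))]
  refine Finset.sum_congr rfl fun a _ => ?_
  rw [Finset.sum_comm]
  simp

lemma U_comm {dA dB : ℕ} (hdA : 0 < dA) (U : Matrix (Fin dA × Fin dB) (Fin dA × Fin dB) ℂ)
    (hU : IsUnitary U) (σ : Matrix (Fin dB) (Fin dB) ℂ) (hσ : IsDensity σ)
    (hcanon : ∀ ρ : Matrix (Fin dA) (Fin dA) ℂ, IsDensity ρ →
      trFst (U * (ρ ⊗ₖ σ) * Uᴴ) = σ) :
    ((1 : Matrix (Fin dA) (Fin dA) ℂ) ⊗ₖ σ) * U = U * ((1 : Matrix (Fin dA) (Fin dA) ℂ) ⊗ₖ σ) := by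
  set S := (1 : Matrix (Fin dA) (Fin dA) ℂ) ⊗ₖ σ with hS
  have hd : (dA : ℂ) ≠ 0 := by exact_mod_cast hdA.ne'
  have hden : IsDensity ((dA : ℂ)⁻¹ • (1 : Matrix (Fin dA) (Fin dA) ℂ)) := by
    refine ⟨PosSemidef.one.smul ?_, ?_⟩
    · have : (0 : ℝ) ≤ (dA : ℝ)⁻¹ := by positivity
      have h' : (0 : ℂ) ≤ (((dA : ℝ)⁻¹ : ℝ) : ℂ) := by exact_mod_cast this
      simpa using h'
    · simp [hd]
  have h1 := hcanon _ hden
  have h2 : trFst (U * S * Uᴴ) = (dA : ℂ) • σ := by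
    rw [← h1, smul_kronecker, Matrix.mul_smul, Matrix.smul_mul]
    ext i j
    simp [trFst, ← Finset.mul_sum, hd]
    rfl
  have hSh : Sᴴ = S := by rw [hS, conjTranspose_kronecker, hσ.1.1.eq, conjTranspose_one]
  set T := U * S * Uᴴ with hT
  have hTh : Tᴴ = T := by
    rw [hT]; simp [conjTranspose_mul, hSh, Matrix.mul_assoc]
  have t1 : (T * S).trace = (S * S).trace := by
    rw [hS, trace_one_kron, h2, ← mul_kronecker_mul, trace_kronecker]
    simp
  have t2 : (T * T).trace = (S * S).trace := by
    have : T * T = U * (S * S) * Uᴴ := by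
      rw [hT]
      calc U * S * Uᴴ * (U * S * Uᴴ) = U * S * (Uᴴ * U) * S * Uᴴ := by
            simp only [Matrix.mul_assoc]
        _ = _ := by rw [hU.2]; simp only [Matrix.mul_assoc, Matrix.mul_one, Matrix.one_mul]
    rw [this, trace_mul_comm, ← Matrix.mul_assoc, hU.2, Matrix.one_mul]
  have h0 : ((T - S)ᴴ * (T - S)).trace = 0 := by
    rw [conjTranspose_sub, hTh, hSh, Matrix.sub_mul, Matrix.mul_sub, Matrix.mul_sub, trace_sub, trace_sub, trace_sub,
      trace_mul_comm S T, t1, t2]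
    ring
  rw [trace_conjTranspose_mul_self_eq_zero_iff, sub_eq_zero] at h0
  have h5 : T * U = U * S := by rw [hT, Matrix.mul_assoc, hU.2, Matrix.mul_one]
  rw [← h5, h0]

lemma proj_comm {N : Type*} [Fintype N] [DecidableEq N] {n : ℕ} (U S : Matrix N N ℂ)
    (Q : Fin n → Matrix N N ℂ) (lam : Fin n → ℝ) (hdist : Function.Injective lam)
    (hS : S = ∑ i, (lam i : ℂ) • Q i) (hc : S * U = U * S)
    (hQ : ∀ i, Q i * Q i = Q i) (horth : ∀ i j, i ≠ j → Q i * Q j = 0) (hres : ∑ i, Q i = 1)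
    (i : Fin n) : Q i * U * Q i = U * Q i := by
  have hr : ∀ i, S * Q i = (lam i : ℂ) • Q i := by
    intro i
    rw [hS, Finset.sum_mul, Finset.sum_eq_single i]
    · rw [Matrix.smul_mul, hQ]
    · intro j _ hj; rw [Matrix.smul_mul, horth _ _ hj, smul_zero]
    · simp
  have hl : ∀ i, Q i * S = (lam i : ℂ) • Q i := by
    intro i
    rw [hS, Finset.mul_sum, Finset.sum_eq_single i]
    · rw [Matrix.mul_smul, hQ]
    · intro j _ hj; rw [Matrix.mul_smul, horth _ _ hj.symm, smul_zero]
    · simp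
  have h0 : ∀ j, j ≠ i → Q j * U * Q i = 0 := by
    intro j hj
    have h : (lam j : ℂ) • (Q j * U * Q i) = (lam i : ℂ) • (Q j * U * Q i) := by
      calc (lam j : ℂ) • (Q j * U * Q i) = (Q j * S) * U * Q i := by
            rw [hl, Matrix.smul_mul, Matrix.smul_mul]
        _ = Q j * U * (S * Q i) := by
            rw [Matrix.mul_assoc (Q j) S U, hc]; simp only [Matrix.mul_assoc]
        _ = _ := by rw [hr, Matrix.mul_smul]
    have h' : ((lam j : ℂ) - lam i) • (Q j * U * Q i) = 0 := by rw [sub_smul, h, sub_self]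
    rcases smul_eq_zero.mp h' with h'' | h''
    · exact absurd (hdist (by exact_mod_cast sub_eq_zero.mp h'')) hj
    · exact h''
  calc Q i * U * Q i = ∑ j, Q j * U * Q i := by
        rw [Finset.sum_eq_single i]
        · intro j _ hj; exact h0 j hj
        · simp
    _ = _ := by rw [← Finset.sum_mul, ← Finset.sum_mul, hres, Matrix.one_mul]

/-- The trace-level core estimate. -/
lemma core {X B : Type*} [Fintype X] [Fintype B] [DecidableEq X] [DecidableEq B]
    (F : Matrix X B ℂ) (P : Matrix B B ℂ) (hP : P.IsHermitian) (hPP : P * P = P) (r : ℕ)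
    (hr : 0 < r) (htr : P.trace = (r : ℂ)) (hF : F * P = F) (hF1 : (Fᴴ * F).trace = 1)
    (M c : ℝ) (hc : 0 ≤ c)
    (h : ((M : ℂ) • (1 : Matrix X X ℂ) - (c : ℂ) • (F * Fᴴ)).PosSemidef) : c / r ≤ M := by
  set G := Fᴴ * F with hG
  have hGP : G * P = G := by rw [hG, Matrix.mul_assoc, hF]
  have hGh : Gᴴ = G := by simp [hG]
  have h1 := (h.conjTranspose_mul_mul_same F).trace_nonneg
  have e1 : Fᴴ * ((M : ℂ) • (1 : Matrix X X ℂ) - (c : ℂ) • (F * Fᴴ)) * F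
      = (M : ℂ) • G - (c : ℂ) • (G * G) := by
    rw [Matrix.mul_sub, Matrix.sub_mul, Matrix.mul_smul, Matrix.smul_mul, Matrix.mul_smul, Matrix.smul_mul, hG, Matrix.mul_one]
    simp only [Matrix.mul_assoc]
  rw [e1, trace_sub, trace_smul, trace_smul, hF1] at h1
  have h2 := (posSemidef_conjTranspose_mul_self (G - ((r : ℂ)⁻¹) • P)).trace_nonneg
  have hPG : P * G = G := by
    have := congrArg conjTranspose hGP
    rwa [conjTranspose_mul, hGh, hP.eq] at this
  have hr' : (r : ℂ) ≠ 0 := by exact_mod_cast hr.ne'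
  have e2 : (G - ((r : ℂ)⁻¹) • P)ᴴ * (G - ((r : ℂ)⁻¹) • P)
      = G * G - (r : ℂ)⁻¹ • G - (r : ℂ)⁻¹ • G + ((r : ℂ)⁻¹ * (r : ℂ)⁻¹) • P := by
    rw [conjTranspose_sub, conjTranspose_smul, hGh, hP.eq]
    simp only [star_inv₀, star_natCast, Matrix.sub_mul, Matrix.mul_sub, Matrix.smul_mul, Matrix.mul_smul, hGP, hPG, hPP,
      smul_smul, smul_sub]
    abel
  rw [e2, trace_add, trace_sub, trace_sub, trace_smul, trace_smul, hF1, htr] at h2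
  have h2re := (Complex.le_def.mp h2).1
  have h1re := (Complex.le_def.mp h1).1
  have e3 : (r : ℂ)⁻¹ * (r : ℂ)⁻¹ * (r : ℂ) = (r : ℂ)⁻¹ := by field_simp
  simp only [smul_eq_mul, mul_one, e3] at h1re h2re
  have e4 : ((r : ℂ)⁻¹).re = (r : ℝ)⁻¹ := by
    rw [← Complex.ofReal_natCast, ← Complex.ofReal_inv, Complex.ofReal_re]
  simp [-Complex.inv_re, e4] at h1re h2re
  have : c * (r : ℝ)⁻¹ ≤ c * (G * G).trace.re := mul_le_mul_of_nonneg_left (by linarith) hc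
  rw [div_eq_mul_inv]
  linarith

lemma key {m dA dB : ℕ} (U : Matrix (Fin dA × Fin dB) (Fin dA × Fin dB) ℂ)
    (hU : Uᴴ * U = 1) (σ : Matrix (Fin dB) (Fin dB) ℂ) (hσ : σ.PosSemidef)
    (P : Matrix (Fin dB) (Fin dB) ℂ) (hP : P.IsHermitian) (hPP : P * P = P) (r : ℕ) (hr : 0 < r)
    (htr : P.trace = (r : ℂ)) (l : ℝ) (hl : 0 ≤ l) (hσP : σ * P = (l : ℂ) • P)
    (hcomm : ((1 : Matrix (Fin dA) (Fin dA) ℂ) ⊗ₖ P) * U * ((1 : Matrix (Fin dA) (Fin dA) ℂ) ⊗ₖ P)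
      = U * ((1 : Matrix (Fin dA) (Fin dA) ℂ) ⊗ₖ P))
    (ρ : Matrix (Fin m × Fin dA) (Fin m × Fin dA) ℂ) (hρ : ρ.PosSemidef)
    (μ : ℝ) (hμ : 0 ≤ μ) (ψ : Matrix (Fin m × Fin dA) Unit ℂ) (hψ : ψᴴ * ψ = 1)
    (hψ2 : ρ * ψ = (μ : ℂ) • ψ) (M : ℝ)
    (hM : ((M : ℂ) • (1 : Matrix (Fin m × Fin dA) (Fin m × Fin dA) ℂ)
      - trSnd ((extUnitary U : Matrix ((Fin m × Fin dA) × Fin dB)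
        ((Fin m × Fin dA) × Fin dB) ℂ) * (ρ ⊗ₖ σ) * (extUnitary U)ᴴ)).PosSemidef) :
    μ * l / r ≤ M := by
  -- a unit vector in the range of P
  obtain ⟨w, hw1, hwP⟩ : ∃ w : Matrix (Fin dB) Unit ℂ, wᴴ * w = 1 ∧ P * w = w := by
    have hP0 : P ≠ 0 := by
      rintro rfl
      rw [trace_zero] at htr
      exact hr.ne' (by exact_mod_cast htr.symm)
    have : ∃ j, ∃ i, P i j ≠ 0 := by
      by_contra hcon
      push Not at hcon
      exact hP0 (by ext i j; exact hcon j i)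
    obtain ⟨j, i, hij⟩ := this
    set s : ℝ := ∑ x, Complex.normSq (P x j) with hs
    have hspos : 0 < s := Finset.sum_pos' (fun x _ => Complex.normSq_nonneg _)
      ⟨i, Finset.mem_univ _, Complex.normSq_pos.mpr hij⟩
    have hsq : (Real.sqrt s) * Real.sqrt s = s := Real.mul_self_sqrt hspos.le
    have hne : Real.sqrt s ≠ 0 := (Real.sqrt_pos.mpr hspos).ne'
    refine ⟨Matrix.of fun x _ => ((Real.sqrt s)⁻¹ : ℝ) * P x j, ?_, ?_⟩
    · ext a b
      simp only [mul_apply, conjTranspose_apply, of_apply, one_apply, if_true, star_mul']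
      have : ∀ x, star (((Real.sqrt s)⁻¹ : ℝ) : ℂ) * star (P x j) * ((((Real.sqrt s)⁻¹ : ℝ) : ℂ) * P x j)
          = (((Real.sqrt s)⁻¹ * (Real.sqrt s)⁻¹ * Complex.normSq (P x j) : ℝ) : ℂ) := by
        intro x
        rw [Complex.ofReal_mul, Complex.normSq_eq_conj_mul_self]
        simp
        ring
      simp only [this]
      rw [← Complex.ofReal_sum, ← Finset.mul_sum, ← hs]
      rw [← mul_inv, hsq, inv_mul_cancel₀ hspos.ne']
      simp
    · ext x a
      have := congrFun (congrFun hPP x) j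
      simp only [mul_apply, of_apply] at this ⊢
      rw [← this, Finset.mul_sum]
      refine Finset.sum_congr rfl fun y _ => ?_
      ring
  have hσw : σ * w = (l : ℂ) • w := by
    rw [← hwP, ← Matrix.mul_assoc, hσP, Matrix.smul_mul]
  have a1 := psd_sub ρ hρ μ ψ hψ hψ2
  have a2 := psd_sub σ hσ l w hw1 hσw
  have hψψ : (ψ * ψᴴ).PosSemidef := posSemidef_self_mul_conjTranspose ψ
  set V : Matrix ((Fin m × Fin dA) × Fin dB) ((Fin m × Fin dA) × Fin dB) ℂ := extUnitary U with hV
  set Φ := V * (ψ ⊗ₖ w) with hΦ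
  have a3 : (ρ ⊗ₖ σ - ((μ * l : ℝ) : ℂ) • ((ψ ⊗ₖ w) * (ψ ⊗ₖ w)ᴴ)).PosSemidef := by
    have e : ρ ⊗ₖ σ - ((μ * l : ℝ) : ℂ) • ((ψ ⊗ₖ w) * (ψ ⊗ₖ w)ᴴ)
        = (ρ - (μ : ℂ) • (ψ * ψᴴ)) ⊗ₖ σ
          + (μ : ℂ) • ((ψ * ψᴴ) ⊗ₖ (σ - (l : ℂ) • (w * wᴴ))) := by
      rw [conjTranspose_kronecker, ← mul_kronecker_mul]
      ext ⟨a, b⟩ ⟨a', b'⟩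
      simp only [Matrix.sub_apply, Matrix.add_apply, Matrix.smul_apply, kroneckerMap_apply, smul_eq_mul]
      push_cast
      ring
    rw [e]
    exact (a1.kronecker hσ).add ((hψψ.kronecker a2).smul (by exact_mod_cast hμ))
  have a4 := trSnd_psd _ (a3.mul_mul_conjTranspose_same V)
  have e4 : V * (ρ ⊗ₖ σ - ((μ * l : ℝ) : ℂ) • ((ψ ⊗ₖ w) * (ψ ⊗ₖ w)ᴴ)) * Vᴴ
      = V * (ρ ⊗ₖ σ) * Vᴴ - ((μ * l : ℝ) : ℂ) • (Φ * Φᴴ) := by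
    rw [Matrix.mul_sub, Matrix.sub_mul, Matrix.mul_smul, Matrix.smul_mul, hΦ, conjTranspose_mul]
    simp only [Matrix.mul_assoc]
  rw [e4, trSnd_sub_smul] at a4
  have a5 := hM.add a4
  rw [sub_add_sub_cancel] at a5
  set F : Matrix (Fin m × Fin dA) (Fin dB) ℂ := Matrix.of fun x b => Φ (x, b) ((), ()) with hFdef
  have e5 : trSnd (Φ * Φᴴ) = F * Fᴴ := by
    ext x y
    simp [trSnd, mul_apply, hFdef, Fintype.sum_prod_type]
  rw [e5] at a5
  have hΦ1 : Φᴴ * Φ = 1 := by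
    rw [hΦ, conjTranspose_mul]
    calc (ψ ⊗ₖ w)ᴴ * Vᴴ * (V * (ψ ⊗ₖ w)) = (ψ ⊗ₖ w)ᴴ * (Vᴴ * V) * (ψ ⊗ₖ w) := by
          simp only [Matrix.mul_assoc]
      _ = 1 := by
          rw [hV, ext_unit U hU, Matrix.mul_one, conjTranspose_kronecker, ← mul_kronecker_mul,
            hψ, hw1, one_kronecker_one]
  have hΦP : ((1 : Matrix (Fin m × Fin dA) (Fin m × Fin dA) ℂ) ⊗ₖ P) * Φ = Φ := by
    have hw' : ((1 : Matrix (Fin m × Fin dA) (Fin m × Fin dA) ℂ) ⊗ₖ P) * (ψ ⊗ₖ w) = ψ ⊗ₖ w := by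
      rw [← mul_kronecker_mul, Matrix.one_mul, hwP]
    rw [hΦ]
    conv_lhs => rw [← hw']
    rw [← Matrix.mul_assoc, ← Matrix.mul_assoc, hV, ext_comm U P hcomm, Matrix.mul_assoc, hw']
  refine core F Pᵀ hP.transpose ?_ r hr ?_ ?_ ?_ M (μ * l) (mul_nonneg hμ hl) a5
  · rw [← transpose_mul, hPP]
  · rw [trace_transpose, htr]
  · ext x b
    have := congrFun (congrFun hΦP (x, b)) ((), ())
    simp only [mul_apply, Fintype.sum_prod_type, kroneckerMap_apply, one_apply] at this
    simp only [mul_apply, transpose_apply, hFdef, of_apply]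
    rw [← this]
    simp only [ite_mul, one_mul, zero_mul]
    rw [← Fintype.sum_prod_type' (f := fun a1 a2 => ∑ x_1, if x = (a1, a2) then P b x_1 * Φ ((a1, a2), x_1) ((), ()) else 0)]
    rw [Finset.sum_eq_single x]
    · simp [mul_comm]
    · intro y _ hy
      simp [hy.symm]
    · simp
  · have := congrFun (congrFun hΦ1 ((), ())) ((), ())
    simp only [mul_apply, one_apply, if_true, conjTranspose_apply, Fintype.sum_prod_type] at this
    rw [← this]
    simp only [trace, diag_apply, mul_apply, conjTranspose_apply, hFdef, of_apply,
      Fintype.sum_prod_type]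
    rw [Finset.sum_comm]
    refine Finset.sum_congr rfl fun a _ => ?_
    rw [Finset.sum_comm]

end helpers

/-- Theorem 6: the min-entropy production of a catalysis is bounded by the catalytic
min-entropy `S_min^◇(σ) = −log₂ maxᵢ (λᵢ/rᵢ)` of the catalyst. -/
theorem stmt12 {dA dB : ℕ} (U : Matrix (Fin dA × Fin dB) (Fin dA × Fin dB) ℂ)
    (hU : IsUnitary U) (σ : Matrix (Fin dB) (Fin dB) ℂ) (hσ : IsDensity σ)
    (hcanon : ∀ ρ : Matrix (Fin dA) (Fin dA) ℂ, IsDensity ρ →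
      trFst (U * (ρ ⊗ₖ σ) * Uᴴ) = σ)
    {n : ℕ} (lam : Fin n → ℝ) (P : Fin n → Matrix (Fin dB) (Fin dB) ℂ) (r : Fin n → ℕ)
    (hdec : σ = ∑ i, (lam i : ℂ) • P i)
    (hdist : Function.Injective lam)
    (hproj : ∀ i, (P i).IsHermitian ∧ P i * P i = P i)
    (horth : ∀ i j, i ≠ j → P i * P j = 0)
    (hres : ∑ i, P i = 1)
    (hrpos : ∀ i, 0 < r i)
    (htr : ∀ i, (P i).trace = (r i : ℂ))
    (m : ℕ) (hm : 0 < m)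
    (ρ : Matrix (Fin m × Fin dA) (Fin m × Fin dA) ℂ) (hρ : IsDensity ρ)
    (ω : Matrix (Fin m × Fin dA) (Fin m × Fin dA) ℂ)
    (hω : ω = trSnd ((extUnitary U : Matrix ((Fin m × Fin dA) × Fin dB)
        ((Fin m × Fin dA) × Fin dB) ℂ) * (ρ ⊗ₖ σ) * (extUnitary U)ᴴ)) :
    minEntropy ω - minEntropy ρ ≤ -Real.logb 2 (⨆ i, lam i / (r i : ℝ)) := by
  have hne : Nonempty (Fin m × Fin dA) := by
    by_contra h
    rw [not_nonempty_iff] at h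
    have := hρ.2
    simp [Matrix.trace] at this
  have hdA : 0 < dA := by
    obtain ⟨_, a⟩ := hne
    exact a.pos
  have hcm := U_comm hdA U hU σ hσ hcanon
  have hσP : ∀ i, σ * P i = (lam i : ℂ) • P i := by
    intro i
    rw [hdec, Finset.sum_mul, Finset.sum_eq_single i]
    · rw [Matrix.smul_mul, (hproj i).2]
    · intro j _ hj; rw [Matrix.smul_mul, horth _ _ hj, smul_zero]
    · simp
  have hsum : ∑ i, lam i * (r i : ℝ) = 1 := by
    have h := hσ.2
    rw [hdec, Matrix.trace_sum] at h
    simp only [Matrix.trace_smul, htr, smul_eq_mul] at h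
    exact_mod_cast h
  have hposi : ∃ i, 0 < lam i := by
    by_contra hcon
    push Not at hcon
    have : ∑ i, lam i * (r i : ℝ) ≤ 0 := Finset.sum_nonpos fun i _ =>
      mul_nonpos_of_nonpos_of_nonneg (hcon i) (by positivity)
    linarith
  obtain ⟨i0, hi0⟩ := hposi
  have : Nonempty (Fin n) := ⟨i0⟩
  obtain ⟨i, hi⟩ := exists_eq_ciSup_of_finite (f := fun i => lam i / (r i : ℝ))
  have hrp : ∀ i, (0 : ℝ) < r i := fun i => by exact_mod_cast hrpos i
  have hge : lam i0 / (r i0 : ℝ) ≤ lam i / (r i : ℝ) := by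
    rw [hi]
    exact le_ciSup (f := fun i => lam i / (r i : ℝ)) (Set.finite_range _).bddAbove i0
  have hq : 0 < lam i / (r i : ℝ) := lt_of_lt_of_le (div_pos hi0 (hrp i0)) hge
  have hli : 0 < lam i := by
    have := mul_pos hq (hrp i)
    rwa [div_mul_cancel₀ _ (hrp i).ne'] at this
  rw [← hi]
  have hμ := maxEig_pos ρ hρ
  obtain ⟨ψ, hψ, hψ2⟩ := maxEig_vec ρ hρ.1.1
  have hωh : ω.IsHermitian := by
    rw [hω]
    exact (trSnd_psd _ ((hρ.1.kronecker hσ.1).mul_mul_conjTranspose_same _)).1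
  have hM := maxEig_sub_psd ω hωh
  have hkc := proj_comm U ((1 : Matrix (Fin dA) (Fin dA) ℂ) ⊗ₖ σ)
    (fun i => (1 : Matrix (Fin dA) (Fin dA) ℂ) ⊗ₖ P i) lam hdist
    (by
      rw [hdec]
      ext ⟨a, b⟩ ⟨a', b'⟩
      simp only [Matrix.kroneckerMap_apply, Matrix.sum_apply, Matrix.smul_apply, smul_eq_mul,
        Finset.mul_sum]
      refine Finset.sum_congr rfl fun j _ => ?_
      ring) hcm
    (fun j => by
      rw [← Matrix.mul_kronecker_mul, (hproj j).2, Matrix.one_mul])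
    (fun j k hjk => by
      rw [← Matrix.mul_kronecker_mul, horth j k hjk, Matrix.kronecker_zero])
    (by
      rw [← Matrix.one_kronecker_one, ← hres]
      ext ⟨a, b⟩ ⟨a', b'⟩
      simp only [Matrix.kroneckerMap_apply, Matrix.sum_apply, Finset.mul_sum]) i
  have hfin : maxEig ρ * lam i / (r i : ℝ) ≤ maxEig ω :=
    key U hU.2 σ hσ.1 (P i) (hproj i).1 (hproj i).2 (r i) (hrpos i) (htr i) (lam i) hli.le (hσP i)
      hkc ρ hρ.1 (maxEig ρ) hμ.le ψ hψ hψ2 (maxEig ω) (by rw [← hω]; exact hM)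
  have hlog : Real.logb 2 (maxEig ρ * (lam i / (r i : ℝ))) ≤ Real.logb 2 (maxEig ω) := by
    apply Real.logb_le_logb_of_le (by norm_num) (mul_pos hμ hq)
    rwa [← mul_div_assoc]
  rw [Real.logb_mul hμ.ne' hq.ne'] at hlog
  unfold minEntropy
  linarith
end

section
/- Let U be a unitary on (ℂ^a ⊗ ℂ^b) ⊗ ℂ^c (systems A₁A₂B) and σ a density matrix on ℂ^c such that Tr_{A₁A₂}(U(ρ ⊗ σ)U†) = σ for every density matrix ρ on ℂ^a ⊗ ℂ^b, and let Ψ(ρ) = Tr_B(U(ρ ⊗ σ)U†) be the implemented channel on A₁A₂. Write the spectral decomposition σ = ∑_i λ_i Π_i with distinct eigenvalues λ_i and multiplicities r_i. Suppose Ψ₁ and Ψ₂ are maps on density matrices of ℂ^a and ℂ^b, respectively, such that for all density matrices ρ on ℂ^a ⊗ ℂ^b, Tr_{A₂}(Ψ(ρ)) = Ψ₁(Tr_{A₂} ρ) and Tr_{A₁}(Ψ(ρ)) = Ψ₂(Tr_{A₁} ρ). Then for all density matrices ρ₁ on ℂ^a and ρ₂ on ℂ^b, setting ω = Ψ(ρ₁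 ⊗ ρ₂): S(ω_{A₁}) + S(ω_{A₂}) − S(ω) ≥ [S(Ψ₁(ρ₁)) − S(ρ₁)] + [S(Ψ₂(ρ₂)) − S(ρ₂)] − S^◇(σ). -/
open scoped Matrix Kronecker BigOperators Classical ComplexOrder

lemma diag_bound {L J : Type*} [Fintype L] [Fintype J] [DecidableEq L]
    (C : Matrix L J ℂ) (w : L → ℝ)
    (h : C * Cᴴ = Matrix.diagonal (fun l => (w l : ℂ))) (j : J) :
    ∑ l, Complex.normSq (C l j) / w l ≤ 1 := by
  set D : Matrix L L ℂ := Matrix.diagonal (fun l => ((w l)⁻¹ : ℂ)) with hD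
  set Q : Matrix J J ℂ := Cᴴ * D * C with hQ
  have hDh : Dᴴ = D := by
    rw [hD, Matrix.diagonal_conjTranspose]
    congr 1
    ext l
    simp
  have hQh : Qᴴ = Q := by
    simp only [hQ, Matrix.conjTranspose_mul, Matrix.conjTranspose_conjTranspose, hDh,
      Matrix.mul_assoc]
  have hDD : D * (C * Cᴴ) * D = D := by
    rw [h, hD, Matrix.diagonal_mul_diagonal, Matrix.diagonal_mul_diagonal]
    congr 1
    ext l
    by_cases h0 : (w l : ℂ) = 0
    · simp [h0]
    · field_simp
  have hQQ : Q * Qᴴ = Q := by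
    rw [hQh]
    calc Q * Q = Cᴴ * (D * (C * Cᴴ) * D) * C := by simp only [hQ, Matrix.mul_assoc]
      _ = Q := by rw [hDD]
  have hs : Q j j = ((∑ l, Complex.normSq (C l j) / w l : ℝ) : ℂ) := by
    rw [hQ, hD, Matrix.mul_apply]
    simp only [Matrix.mul_diagonal, Matrix.conjTranspose_apply]
    push_cast
    refine Finset.sum_congr rfl fun l _ => ?_
    rw [Complex.normSq_eq_conj_mul_self, div_eq_mul_inv]
    simp only [Complex.star_def]
    ring
  have h2 : ∑ k, Complex.normSq (Q j k) = ∑ l, Complex.normSq (C l j) / w l := by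
    have := congrFun (congrFun hQQ j) j
    rw [hs, Matrix.mul_apply] at this
    have h3 : ∀ k, Q j k * Qᴴ k j = ((Complex.normSq (Q j k) : ℝ) : ℂ) := by
      intro k
      rw [Matrix.conjTranspose_apply, Complex.star_def, Complex.mul_conj]
    simp only [h3] at this
    exact_mod_cast this
  have h4 : Complex.normSq (Q j j) ≤ ∑ k, Complex.normSq (Q j k) :=
    Finset.single_le_sum (f := fun k => Complex.normSq (Q j k))
      (fun k _ => Complex.normSq_nonneg _) (Finset.mem_univ j)
  rw [h2, hs, Complex.normSq_ofReal] at h4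
  nlinarith

lemma mul_conj_diag {L J : Type*} [Fintype J] (C : Matrix L J ℂ) (l : L) :
    (C * Cᴴ) l l = ((∑ j, Complex.normSq (C l j) : ℝ) : ℂ) := by
  rw [Matrix.mul_apply]
  push_cast
  refine Finset.sum_congr rfl fun k _ => ?_
  rw [Matrix.conjTranspose_apply, Complex.star_def, Complex.mul_conj]

lemma conj_mul_diag {L J : Type*} [Fintype L] (C : Matrix L J ℂ) (j : J) :
    (Cᴴ * C) j j = ((∑ l, Complex.normSq (C l j) : ℝ) : ℂ) := by
  rw [Matrix.mul_apply]
  push_cast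
  refine Finset.sum_congr rfl fun k _ => ?_
  rw [Matrix.conjTranspose_apply, Complex.star_def, Complex.normSq_eq_conj_mul_self]

lemma entropy_bound {X J : Type*} [Fintype X] [Fintype J] [DecidableEq X]
    (V : Matrix X J ℂ) (t : J → ℝ) (ht : ∀ j, 0 ≤ t j)
    (hz : ∀ j, t j = 0 → ∀ x, V x j = 0)
    (hsum : ∑ j, t j ≤ ∑ j, ∑ x, Complex.normSq (V x j)) :
    vnEntropy (V * Vᴴ) ≤ -∑ j, (∑ x, Complex.normSq (V x j)) * Real.logb 2 (t j) := by
  have hH : (V * Vᴴ).IsHermitian := Matrix.isHermitian_mul_conjTranspose_self V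
  rw [vnEntropy, dif_pos hH, neg_le_neg_iff]
  set w := hH.eigenvalues with hw
  set E : Matrix X X ℂ := (hH.eigenvectorUnitary : Matrix X X ℂ) with hE
  have hEE : E * Eᴴ = 1 := by
    rw [hE, ← Matrix.star_eq_conjTranspose]
    exact Unitary.coe_mul_star_self _
  have hEE' : Eᴴ * E = 1 := by
    rw [hE, ← Matrix.star_eq_conjTranspose]
    exact Unitary.coe_star_mul_self _
  have hspec : V * Vᴴ = E * Matrix.diagonal (fun l => (w l : ℂ)) * Eᴴ := by
    have := hH.spectral_theorem
    rw [Unitary.conjStarAlgAut_apply] at this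
    exact this
  set C : Matrix X J ℂ := Eᴴ * V with hC
  have hCC : C * Cᴴ = Matrix.diagonal (fun l => (w l : ℂ)) := by
    calc C * Cᴴ = Eᴴ * (V * Vᴴ) * E := by
          simp only [hC, Matrix.conjTranspose_mul, Matrix.conjTranspose_conjTranspose,
            Matrix.mul_assoc]
      _ = (Eᴴ * E) * Matrix.diagonal (fun l => (w l : ℂ)) * (Eᴴ * E) := by
          rw [hspec]; simp only [Matrix.mul_assoc]
      _ = _ := by rw [hEE']; simp
  have hCV : Cᴴ * C = Vᴴ * V := by
    calc Cᴴ * C = Vᴴ * (E * Eᴴ) * V := by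
          simp only [hC, Matrix.conjTranspose_mul, Matrix.conjTranspose_conjTranspose,
            Matrix.mul_assoc]
      _ = _ := by rw [hEE]; simp
  have hrow : ∀ l, ∑ j, Complex.normSq (C l j) = w l := by
    intro l
    have := mul_conj_diag C l
    rw [hCC, Matrix.diagonal_apply_eq] at this
    exact_mod_cast this.symm
  have hcol : ∀ j, ∑ l, Complex.normSq (C l j) = ∑ x, Complex.normSq (V x j) := by
    intro j
    have h1 := conj_mul_diag C j
    rw [hCV, conj_mul_diag V j] at h1
    exact_mod_cast h1.symm
  have hzC : ∀ j, t j = 0 → ∀ l, Complex.normSq (C l j) = 0 := by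
    intro j hj l
    rw [hC, Matrix.mul_apply]
    simp [hz j hj]
  have hterm : ∀ l j, Complex.normSq (C l j) - t j * (Complex.normSq (C l j) / w l) ≤
      Complex.normSq (C l j) * (Real.log (w l) - Real.log (t j)) := by
    intro l j
    have hA := Complex.normSq_nonneg (C l j)
    rcases hA.eq_or_lt with h0 | hpos
    · rw [← h0]; simp
    have hwl : 0 < w l := by
      rw [← hrow l]
      exact lt_of_lt_of_le hpos (Finset.single_le_sum (f := fun k => Complex.normSq (C l k))
        (fun k _ => Complex.normSq_nonneg _) (Finset.mem_univ j))
    have htj : 0 < t j := by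
      rcases (ht j).eq_or_lt with h | h
      · exact absurd (hzC j h.symm l) hpos.ne'
      · exact h
    have hl := Real.log_le_sub_one_of_pos (div_pos htj hwl)
    rw [Real.log_div htj.ne' hwl.ne'] at hl
    have h5 : Complex.normSq (C l j) - t j * (Complex.normSq (C l j) / w l) =
      Complex.normSq (C l j) * (1 - t j / w l) := by ring
    rw [h5]
    exact mul_le_mul_of_nonneg_left (by linarith) hA
  have hS := Finset.sum_le_sum fun j (_ : j ∈ Finset.univ) =>
    Finset.sum_le_sum fun l (_ : l ∈ Finset.univ) => hterm l j
  have hL : 0 ≤ ∑ j, ∑ l, (Complex.normSq (C l j) - t j * (Complex.normSq (C l j) / w l)) := by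
    have : ∑ j, ∑ l, (Complex.normSq (C l j) - t j * (Complex.normSq (C l j) / w l)) =
        ∑ j, ∑ x, Complex.normSq (V x j) - ∑ j, t j * ∑ l, Complex.normSq (C l j) / w l := by
      rw [← Finset.sum_sub_distrib]
      refine Finset.sum_congr rfl fun j _ => ?_
      rw [Finset.sum_sub_distrib, hcol, Finset.mul_sum]
    rw [this]
    have : ∑ j, t j * ∑ l, Complex.normSq (C l j) / w l ≤ ∑ j, t j :=
      Finset.sum_le_sum fun j _ => by
        have := mul_le_mul_of_nonneg_left (diag_bound C w hCC j) (ht j)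
        linarith
    linarith
  have hR : ∑ j, ∑ l, Complex.normSq (C l j) * (Real.log (w l) - Real.log (t j)) =
      ∑ l, w l * Real.log (w l) - ∑ j, (∑ x, Complex.normSq (V x j)) * Real.log (t j) := by
    simp only [mul_sub, Finset.sum_sub_distrib]
    congr 1
    · rw [Finset.sum_comm]
      refine Finset.sum_congr rfl fun l _ => ?_
      rw [← Finset.sum_mul, hrow]
    · refine Finset.sum_congr rfl fun j _ => ?_
      rw [← Finset.sum_mul, hcol]
  have hfin : ∑ j, (∑ x, Complex.normSq (V x j)) * Real.log (t j) ≤ ∑ l, w l * Real.log (w l) := by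
    linarith
  simp only [Real.logb, mul_div_assoc', ← Finset.sum_div]
  exact div_le_div_of_nonneg_right hfin (Real.log_pos (by norm_num)).le

lemma trace_mul_one_kron {X B : Type*} [Fintype X] [Fintype B] [DecidableEq X]
    (M : Matrix (X × B) (X × B) ℂ) (σ : Matrix B B ℂ) :
    (M * ((1 : Matrix X X ℂ) ⊗ₖ σ)).trace = (trFst M * σ).trace := by
  simp only [Matrix.trace, Matrix.diag, Matrix.mul_apply, Fintype.sum_prod_type,
    Matrix.kroneckerMap_apply, Matrix.one_apply, trFst, Matrix.of_apply, ite_mul, mul_ite,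
    one_mul, zero_mul, mul_zero, Finset.sum_mul]
  have : ∀ x : X, ∀ y : B, (∑ x_2 : X, ∑ x_3 : B,
      if x_2 = x then M (x, y) (x_2, x_3) * σ x_3 y else 0) =
      ∑ x_3 : B, M (x, y) (x, x_3) * σ x_3 y := by
    intro x y
    rw [Finset.sum_eq_single x]
    · simp
    · intro z _ hz; simp [hz]
    · simp
  simp only [this]
  rw [Finset.sum_comm]
  refine Finset.sum_congr rfl fun y _ => ?_
  rw [Finset.sum_comm]

lemma commute_of_fixed {X B : Type*} [Fintype X] [Fintype B] [DecidableEq X] [DecidableEq B]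
    (U : Matrix (X × B) (X × B) ℂ) (hU : IsUnitary U) (σ : Matrix B B ℂ) (hσ : σ.IsHermitian)
    (h : trFst (U * ((1 : Matrix X X ℂ) ⊗ₖ σ) * Uᴴ) = (Fintype.card X : ℂ) • σ) :
    U * ((1 : Matrix X X ℂ) ⊗ₖ σ) = ((1 : Matrix X X ℂ) ⊗ₖ σ) * U := by
  set T := (1 : Matrix X X ℂ) ⊗ₖ σ with hT
  have hTh : Tᴴ = T := by
    rw [hT, Matrix.conjTranspose_kronecker, hσ.eq]; simp
  have hTT : (T * T).trace = (Fintype.card X : ℂ) * (σ * σ).trace := by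
    rw [hT, ← Matrix.mul_kronecker_mul, Matrix.trace_kronecker]; simp
  have hc : (U * T * Uᴴ * T).trace = (T * T).trace := by
    rw [hTT, hT, trace_mul_one_kron, h, Matrix.smul_mul, Matrix.trace_smul, smul_eq_mul]
  obtain ⟨h1, h2⟩ := hU
  have hz : ((U * T - T * U) * (U * T - T * U)ᴴ).trace = 0 := by
    have e1 : U * T * (T * Uᴴ) = U * (T * T) * Uᴴ := by simp only [Matrix.mul_assoc]
    have e2 : U * T * (Uᴴ * T) = U * T * Uᴴ * T := by simp only [Matrix.mul_assoc]
    have e3 : T * U * (T * Uᴴ) = T * (U * T * Uᴴ) := by simp only [Matrix.mul_assoc]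
    have e4 : T * U * (Uᴴ * T) = T * (U * Uᴴ) * T := by simp only [Matrix.mul_assoc]
    rw [Matrix.conjTranspose_sub, Matrix.conjTranspose_mul, Matrix.conjTranspose_mul, hTh,
      Matrix.sub_mul, Matrix.mul_sub, Matrix.mul_sub, e1, e2, e3, e4, h1, Matrix.trace_sub,
      Matrix.trace_sub, Matrix.trace_sub, hc, Matrix.trace_mul_comm T (U * T * Uᴴ), hc, Matrix.mul_one,
      Matrix.trace_mul_comm _ Uᴴ, ← Matrix.mul_assoc, h2, Matrix.one_mul]
    ring
  have := Matrix.trace_mul_conjTranspose_self_eq_zero_iff.mp hz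
  exact sub_eq_zero.mp this

lemma herm_diag {n : Type*} [Fintype n] [DecidableEq n] (ρ : Matrix n n ℂ) (hρ : IsDensity ρ) :
    ∃ (E : Matrix n n ℂ) (μ : n → ℝ), E * Eᴴ = 1 ∧ Eᴴ * E = 1 ∧
      ρ = E * Matrix.diagonal (fun l => (μ l : ℂ)) * Eᴴ ∧ (∀ i, 0 ≤ μ i) ∧ ∑ i, μ i = 1 ∧
      vnEntropy ρ = -∑ i, μ i * Real.logb 2 (μ i) := by
  have hH := hρ.1.isHermitian
  refine ⟨(hH.eigenvectorUnitary : Matrix n n ℂ), hH.eigenvalues, ?_, ?_, ?_, ?_, ?_, ?_⟩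
  · rw [← Matrix.star_eq_conjTranspose]
    exact Unitary.coe_mul_star_self _
  · rw [← Matrix.star_eq_conjTranspose]
    exact Unitary.coe_star_mul_self _
  · have := hH.spectral_theorem
    rw [Unitary.conjStarAlgAut_apply] at this
    exact this
  · exact hρ.1.eigenvalues_nonneg
  · have := hH.trace_eq_sum_eigenvalues
    rw [hρ.2] at this
    have h2 : ((∑ i, hH.eigenvalues i : ℝ) : ℂ) = 1 := by
      rw [this]; push_cast; rfl
    exact_mod_cast h2
  · rw [vnEntropy, dif_pos hH]

lemma sum_spec {B : Type*} [Fintype B] [DecidableEq B] (σ W : Matrix B B ℂ) (s : B → ℝ)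
    (hW : Wᴴ * W = 1)
    (hσ : σ = W * Matrix.diagonal (fun l => (s l : ℂ)) * Wᴴ)
    {n : ℕ} (lam : Fin n → ℝ) (P : Fin n → Matrix B B ℂ) (r : Fin n → ℕ)
    (hdec : σ = ∑ i, (lam i : ℂ) • P i)
    (hproj : ∀ i, P i * P i = P i)
    (horth : ∀ i j, i ≠ j → P i * P j = 0)
    (hres : ∑ i, P i = 1)
    (htr : ∀ i, (P i).trace = (r i : ℂ)) (f : ℝ → ℝ) :
    ∑ m, f (s m) = ∑ i, (r i : ℝ) * f (lam i) := by
  have hW' : W * Wᴴ = 1 := mul_eq_one_comm.mp hW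
  have hpow1 : ∀ k : ℕ, σ ^ k = ∑ i, ((lam i : ℂ) ^ k) • P i := by
    intro k
    induction k with
    | zero => simp [hres]
    | succ k ih =>
      rw [pow_succ, ih]
      conv_lhs => rw [hdec]
      rw [Finset.sum_mul]
      refine Finset.sum_congr rfl fun i _ => ?_
      rw [Finset.mul_sum, Finset.sum_eq_single i]
      · rw [Matrix.smul_mul, Matrix.mul_smul, hproj, smul_smul, pow_succ]
      · intro j _ hj
        rw [Matrix.smul_mul, Matrix.mul_smul, horth i j hj.symm]; simp
      · simp
  have hpow2 : ∀ k : ℕ, σ ^ k = W * Matrix.diagonal (fun l => (s l : ℂ) ^ k) * Wᴴ := by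
    intro k
    induction k with
    | zero => simp [hW']
    | succ k ih =>
      rw [pow_succ, ih]
      conv_lhs => rw [hσ]
      calc _ = W * (Matrix.diagonal (fun l => (s l : ℂ) ^ k) * (Wᴴ * W) *
            Matrix.diagonal (fun l => (s l : ℂ))) * Wᴴ := by simp only [Matrix.mul_assoc]
        _ = _ := by
          rw [hW, Matrix.mul_one, Matrix.diagonal_mul_diagonal]
          simp only [pow_succ]
  have hmom : ∀ k : ℕ, ∑ m, s m ^ k = ∑ i, (r i : ℝ) * lam i ^ k := by
    intro k
    have h1 : (σ ^ k).trace = ∑ m, (s m : ℂ) ^ k := by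
      rw [hpow2, Matrix.trace_mul_comm, ← Matrix.mul_assoc, hW, Matrix.one_mul,
        Matrix.trace_diagonal]
    have h2 : (σ ^ k).trace = ∑ i, (r i : ℂ) * (lam i : ℂ) ^ k := by
      rw [hpow1, Matrix.trace_sum]
      refine Finset.sum_congr rfl fun i _ => ?_
      rw [Matrix.trace_smul, htr, smul_eq_mul, mul_comm]
    rw [h1] at h2
    exact_mod_cast h2
  have hpoly : ∀ p : Polynomial ℝ, ∑ m, p.eval (s m) = ∑ i, (r i : ℝ) * p.eval (lam i) := by
    intro p
    simp only [Polynomial.eval_eq_sum_range, Finset.mul_sum]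
    rw [Finset.sum_comm, Finset.sum_comm (s := (Finset.univ : Finset (Fin n)))]
    refine Finset.sum_congr rfl fun k _ => ?_
    rw [← Finset.mul_sum, hmom, Finset.mul_sum]
    exact Finset.sum_congr rfl fun i _ => by ring
  let N : Finset ℝ := Finset.univ.image s ∪ Finset.univ.image lam
  let p := Lagrange.interpolate N id f
  have hp : ∀ x ∈ N, p.eval x = f x := fun x hx =>
    Lagrange.eval_interpolate_at_node f (Function.injective_id.injOn) hx
  have := hpoly p
  have e1 : ∀ m, p.eval (s m) = f (s m) := fun m => hp _ (by simp [N])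
  have e2 : ∀ i, p.eval (lam i) = f (lam i) := fun i => hp _ (by simp [N])
  simpa only [e1, e2] using this

lemma trSnd_conj {X B : Type*} [Fintype X] [Fintype B] [DecidableEq X] [DecidableEq B]
    (M : Matrix (X × B) (X × B) ℂ) (W : Matrix B B ℂ) (hW : W * Wᴴ = 1) :
    trSnd (((1 : Matrix X X ℂ) ⊗ₖ Wᴴ) * M * ((1 : Matrix X X ℂ) ⊗ₖ W)) = trSnd M := by
  ext x y
  have h := fun p q => congrFun (congrFun hW p) q
  simp only [Matrix.mul_apply, Matrix.conjTranspose_apply] at h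
  have hl : ∀ k, (((1 : Matrix X X ℂ) ⊗ₖ Wᴴ) * M * ((1 : Matrix X X ℂ) ⊗ₖ W)) (x, k) (y, k) =
      ∑ q, ∑ p, star (W p k) * M (x, p) (y, q) * W q k := by
    intro k
    simp only [Matrix.mul_apply, Fintype.sum_prod_type, Matrix.kroneckerMap_apply,
      Matrix.one_apply, Matrix.conjTranspose_apply]
    rw [Finset.sum_eq_single y]
    · refine Finset.sum_congr rfl fun q _ => ?_
      rw [Finset.sum_eq_single x]
      · simp [Finset.sum_mul]
      · intro z _ hz; simp [hz.symm]
      · simp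
    · intro z _ hz; simp [hz]
    · simp
  simp only [trSnd, Matrix.of_apply, hl]
  rw [Finset.sum_comm]
  have : ∀ q, ∑ k, ∑ p, star (W p k) * M (x, p) (y, q) * W q k = M (x, q) (y, q) := by
    intro q
    rw [Finset.sum_comm]
    have : ∀ p, ∑ k, star (W p k) * M (x, p) (y, q) * W q k =
        M (x, p) (y, q) * (1 : Matrix B B ℂ) q p := by
      intro p
      rw [← h q p, Finset.mul_sum]
      exact Finset.sum_congr rfl fun k _ => by ring
    simp only [this, Matrix.one_apply]
    simp
  simp only [this]

lemma main_bound {X B : Type*} [Fintype X] [Fintype B] [DecidableEq X] [DecidableEq B]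
    (U : Matrix (X × B) (X × B) ℂ) (hU : IsUnitary U) (ρ E : Matrix X X ℂ) (σ W : Matrix B B ℂ)
    (μ : X → ℝ) (s : B → ℝ)
    (hE : Eᴴ * E = 1) (hW : Wᴴ * W = 1)
    (hρ : ρ = E * Matrix.diagonal (fun l => (μ l : ℂ)) * Eᴴ)
    (hσ : σ = W * Matrix.diagonal (fun l => (s l : ℂ)) * Wᴴ)
    (hμ : ∀ i, 0 ≤ μ i) (hs : ∀ i, 0 ≤ s i) (hμ1 : ∑ i, μ i = 1) (hs1 : ∑ i, s i = 1)
    (hcomm : U * ((1 : Matrix X X ℂ) ⊗ₖ σ) = ((1 : Matrix X X ℂ) ⊗ₖ σ) * U) :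
    vnEntropy (trSnd (U * (ρ ⊗ₖ σ) * Uᴴ)) ≤ -∑ i, μ i * Real.logb 2 (μ i)
      - ∑ n, s n * Real.logb 2 (s n / ((Finset.univ.filter fun m => s m = s n).card : ℝ)) := by
  have hW' : W * Wᴴ = 1 := mul_eq_one_comm.mp hW
  set dμ : Matrix X X ℂ := Matrix.diagonal (fun l => (μ l : ℂ)) with hdμ
  set ds : Matrix B B ℂ := Matrix.diagonal (fun l => (s l : ℂ)) with hds
  set G : Matrix (X × B) (X × B) ℂ := ((1 : Matrix X X ℂ) ⊗ₖ Wᴴ) * U * (E ⊗ₖ W) with hG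
  have hk1 : ((1 : Matrix X X ℂ) ⊗ₖ W) * ((1 : Matrix X X ℂ) ⊗ₖ Wᴴ) = 1 := by
    rw [← Matrix.mul_kronecker_mul, hW']; simp
  have hGh : Gᴴ = (Eᴴ ⊗ₖ Wᴴ) * (Uᴴ * ((1 : Matrix X X ℂ) ⊗ₖ W)) := by
    simp [hG, Matrix.conjTranspose_mul, Matrix.conjTranspose_kronecker]
  have hGG : Gᴴ * G = 1 := by
    calc Gᴴ * G = (Eᴴ ⊗ₖ Wᴴ) * (Uᴴ * (((1 : Matrix X X ℂ) ⊗ₖ W) * ((1 : Matrix X X ℂ) ⊗ₖ Wᴴ))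
          * U) * (E ⊗ₖ W) := by rw [hGh, hG]; simp only [Matrix.mul_assoc]
      _ = 1 := by
        rw [hk1, Matrix.mul_one, hU.2, Matrix.mul_one, ← Matrix.mul_kronecker_mul, hE, hW]; simp
  have hω : trSnd (U * (ρ ⊗ₖ σ) * Uᴴ) = trSnd (G * (dμ ⊗ₖ ds) * Gᴴ) := by
    rw [← trSnd_conj (U * (ρ ⊗ₖ σ) * Uᴴ) W hW', hGh, hG, hρ, hσ, Matrix.mul_kronecker_mul,
      Matrix.mul_kronecker_mul]
    simp only [Matrix.mul_assoc]
  have hGc : G * ((1 : Matrix X X ℂ) ⊗ₖ ds) = ((1 : Matrix X X ℂ) ⊗ₖ ds) * G := by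
    have e1 : W * ds = σ * W := by rw [hσ, Matrix.mul_assoc, hW, Matrix.mul_one]
    have e2 : ds * Wᴴ = Wᴴ * σ := by
      rw [hσ, ← Matrix.mul_assoc, ← Matrix.mul_assoc, hW, Matrix.one_mul]
    have e3 : (E ⊗ₖ W) * ((1 : Matrix X X ℂ) ⊗ₖ ds) = ((1 : Matrix X X ℂ) ⊗ₖ σ) * (E ⊗ₖ W) := by
      rw [← Matrix.mul_kronecker_mul, ← Matrix.mul_kronecker_mul, e1]; simp
    have e4 : ((1 : Matrix X X ℂ) ⊗ₖ ds) * ((1 : Matrix X X ℂ) ⊗ₖ Wᴴ) =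
        ((1 : Matrix X X ℂ) ⊗ₖ Wᴴ) * ((1 : Matrix X X ℂ) ⊗ₖ σ) := by
      rw [← Matrix.mul_kronecker_mul, ← Matrix.mul_kronecker_mul, e2]
    calc G * ((1 : Matrix X X ℂ) ⊗ₖ ds)
        = ((1 : Matrix X X ℂ) ⊗ₖ Wᴴ) * U * ((E ⊗ₖ W) * ((1 : Matrix X X ℂ) ⊗ₖ ds)) := by
          rw [hG]; simp only [Matrix.mul_assoc]
      _ = ((1 : Matrix X X ℂ) ⊗ₖ Wᴴ) * (U * ((1 : Matrix X X ℂ) ⊗ₖ σ)) * (E ⊗ₖ W) := by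
          rw [e3]; simp only [Matrix.mul_assoc]
      _ = (((1 : Matrix X X ℂ) ⊗ₖ Wᴴ) * ((1 : Matrix X X ℂ) ⊗ₖ σ)) * U * (E ⊗ₖ W) := by
          rw [hcomm]; simp only [Matrix.mul_assoc]
      _ = _ := by rw [← e4, hG]; simp only [Matrix.mul_assoc]
  have hk2 : (1 : Matrix X X ℂ) ⊗ₖ ds = Matrix.diagonal (fun p : X × B => (s p.2 : ℂ)) := by
    rw [hds, ← Matrix.diagonal_one, Matrix.diagonal_kronecker_diagonal]; simp
  have hk3 : dμ ⊗ₖ ds = Matrix.diagonal (fun p : X × B => (μ p.1 : ℂ) * (s p.2 : ℂ)) := by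
    rw [hds, hdμ, Matrix.diagonal_kronecker_diagonal]
  have hG0 : ∀ x m k n, s m ≠ s n → G (x, m) (k, n) = 0 := by
    intro x m k n hmn
    rw [hk2] at hGc
    have := congrFun (congrFun hGc (x, m)) (k, n)
    rw [Matrix.mul_diagonal, Matrix.diagonal_mul] at this
    have h2 : ((s m : ℂ) - s n) * G (x, m) (k, n) = 0 := by
      simp only at this
      linear_combination -this
    rcases mul_eq_zero.mp h2 with h | h
    · exact absurd (by exact_mod_cast sub_eq_zero.mp h) hmn
    · exact h
  let R : B → ℝ := fun n => ((Finset.univ.filter fun m => s m = s n).card : ℝ)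
  have hR : ∀ n, 0 < R n := by
    intro n
    have : 0 < (Finset.univ.filter fun m => s m = s n).card :=
      Finset.card_pos.mpr ⟨n, by simp⟩
    exact Nat.cast_pos.mpr this
  let V : Matrix X (B × B × X) ℂ := Matrix.of fun x j =>
    G (x, j.1) (j.2.2, j.2.1) * ((Real.sqrt (μ j.2.2 * s j.2.1) : ℝ) : ℂ)
  let t : B × B × X → ℝ := fun j =>
    if s j.1 = s j.2.1 then μ j.2.2 * s j.2.1 / R j.2.1 else 0
  have hVV : trSnd (G * (dμ ⊗ₖ ds) * Gᴴ) = V * Vᴴ := by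
    ext x y
    simp only [trSnd, Matrix.of_apply, hk3, Matrix.mul_apply (N := Gᴴ), Matrix.mul_apply (M := V),
      Matrix.mul_diagonal, Fintype.sum_prod_type, Matrix.conjTranspose_apply, V]
    refine Finset.sum_congr rfl fun m _ => ?_
    rw [Finset.sum_comm]
    refine Finset.sum_congr rfl fun n _ => Finset.sum_congr rfl fun k _ => ?_
    have hq : ((Real.sqrt (μ k * s n) : ℝ) : ℂ) * ((Real.sqrt (μ k * s n) : ℝ) : ℂ)
        = (μ k : ℂ) * s n := by
      rw [← Complex.ofReal_mul, Real.mul_self_sqrt (mul_nonneg (hμ k) (hs n))]; simp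
    simp only [star_mul', Complex.star_def, Complex.conj_ofReal]
    linear_combination -(G (x, m) (k, n) * (starRingEnd ℂ) (G (y, m) (k, n))) * hq
  have hnV : ∀ m n k, ∑ x, Complex.normSq (V x (m, n, k)) =
      (∑ x, Complex.normSq (G (x, m) (k, n))) * (μ k * s n) := by
    intro m n k
    rw [Finset.sum_mul]
    refine Finset.sum_congr rfl fun x _ => ?_
    simp only [V, Matrix.of_apply, Complex.normSq_mul, Complex.normSq_ofReal]
    rw [Real.mul_self_sqrt (mul_nonneg (hμ k) (hs n))]
  have hGcol : ∀ k n, ∑ m, ∑ x, Complex.normSq (G (x, m) (k, n)) = 1 := by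
    intro k n
    have := conj_mul_diag G (k, n)
    rw [hGG, Matrix.one_apply_eq, Fintype.sum_prod_type, Finset.sum_comm] at this
    exact_mod_cast this.symm
  have hB := entropy_bound V t ?_ ?_ ?_
  · rw [hω, hVV]
    refine hB.trans (le_of_eq ?_)
    have hj : ∀ m n k, (∑ x, Complex.normSq (V x (m, n, k))) * Real.logb 2 (t (m, n, k)) =
        (∑ x, Complex.normSq (G (x, m) (k, n))) *
          (μ k * s n * Real.logb 2 (μ k) + μ k * s n * Real.logb 2 (s n / R n)) := by
      intro m n k
      rw [hnV]
      by_cases hmn : s m = s n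
      · have : t (m, n, k) = μ k * (s n / R n) := by
          simp only [t, if_pos hmn]; ring
        rw [this]
        rcases eq_or_ne (μ k) 0 with h0 | h0
        · simp [h0]
        rcases eq_or_ne (s n) 0 with h1 | h1
        · simp [h1]
        rw [Real.logb_mul h0 (div_ne_zero h1 (hR n).ne')]
        ring
      · have : ∑ x, Complex.normSq (G (x, m) (k, n)) = 0 :=
          Finset.sum_eq_zero fun x _ => by rw [hG0 x m k n hmn]; simp
        rw [this]; simp
    have hsum : ∑ j : B × B × X, (∑ x, Complex.normSq (V x j)) * Real.logb 2 (t j) =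
        ∑ k, μ k * Real.logb 2 (μ k) + ∑ n, s n * Real.logb 2 (s n / R n) := by
      simp only [Fintype.sum_prod_type, hj]
      rw [Finset.sum_comm]
      have : ∀ n, ∑ m, ∑ k, (∑ x, Complex.normSq (G (x, m) (k, n))) *
          (μ k * s n * Real.logb 2 (μ k) + μ k * s n * Real.logb 2 (s n / R n)) =
          s n * (∑ k, μ k * Real.logb 2 (μ k)) + s n * Real.logb 2 (s n / R n) := by
        intro n
        rw [Finset.sum_comm]
        simp only [← Finset.sum_mul, hGcol, one_mul, Finset.sum_add_distrib]
        rw [hμ1, one_mul, Finset.mul_sum]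
        congr 1
        exact Finset.sum_congr rfl fun k _ => by ring
      simp only [this, Finset.sum_add_distrib, ← Finset.sum_mul, hs1, one_mul]
    rw [hsum]
    ring
  · rintro ⟨m, n, k⟩
    simp only [t]
    split_ifs
    · exact div_nonneg (mul_nonneg (hμ k) (hs n)) (hR n).le
    · exact le_rfl
  · rintro ⟨m, n, k⟩ h0 x
    simp only [V, Matrix.of_apply]
    by_cases hmn : s m = s n
    · simp only [t, if_pos hmn] at h0
      rcases div_eq_zero_iff.mp h0 with h | h
      · rw [h]; simp
      · exact absurd h (hR n).ne'
    · rw [hG0 x m k n hmn, zero_mul]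
  · have h1 : ∑ j, t j = 1 := by
      simp only [Fintype.sum_prod_type]
      rw [Finset.sum_comm]
      have : ∀ n, ∑ m, ∑ k, t (m, n, k) = s n := by
        intro n
        have h2 : ∀ m, ∑ k, t (m, n, k) = if s m = s n then s n / R n else 0 := by
          intro m
          simp only [t]
          split_ifs
          · rw [← Finset.sum_div, ← Finset.sum_mul, hμ1, one_mul]
          · simp
        simp only [h2]
        rw [← Finset.sum_filter, Finset.sum_const, nsmul_eq_mul]
        exact mul_div_cancel₀ _ (hR n).ne'
      simp only [this, hs1]
    have h2 : ∑ j, ∑ x, Complex.normSq (V x j) = 1 := by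
      simp only [Fintype.sum_prod_type, hnV]
      rw [Finset.sum_comm]
      have : ∀ n, ∑ m, ∑ k, (∑ x, Complex.normSq (G (x, m) (k, n))) * (μ k * s n) = s n := by
        intro n
        rw [Finset.sum_comm]
        simp only [← Finset.sum_mul, hGcol, one_mul, hμ1]
      simp only [this, hs1]
    rw [h1, h2]

lemma trFst_smul {X B : Type*} [Fintype X] (z : ℂ) (M : Matrix (X × B) (X × B) ℂ) :
    trFst (z • M) = z • trFst M := by
  ext i j
  simp [trFst, Finset.mul_sum]

/-- Theorem 9: depletion of catalyst. If a catalysis implements `Ψ` whose marginals are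
`Ψ₁` and `Ψ₂`, the output mutual information on product inputs is at least the sum of the
local entropy productions minus the catalytic entropy of the catalyst. -/
theorem stmt16 {a b c : ℕ}
    (U : Matrix ((Fin a × Fin b) × Fin c) ((Fin a × Fin b) × Fin c) ℂ) (hU : IsUnitary U)
    (σ : Matrix (Fin c) (Fin c) ℂ) (hσ : IsDensity σ)
    (hcat : ∀ ρ : Matrix (Fin a × Fin b) (Fin a × Fin b) ℂ, IsDensity ρ →
      trFst (U * (ρ ⊗ₖ σ) * Uᴴ) = σ)
    {n : ℕ} (lam : Fin n → ℝ) (P : Fin n → Matrix (Fin c) (Fin c) ℂ) (r : Fin n → ℕ)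
    (hdec : σ = ∑ i, (lam i : ℂ) • P i)
    (hdist : Function.Injective lam)
    (hproj : ∀ i, (P i).IsHermitian ∧ P i * P i = P i)
    (horth : ∀ i j, i ≠ j → P i * P j = 0)
    (hres : ∑ i, P i = 1)
    (hrpos : ∀ i, 0 < r i)
    (htr : ∀ i, (P i).trace = (r i : ℂ))
    (Ψ₁ : Matrix (Fin a) (Fin a) ℂ → Matrix (Fin a) (Fin a) ℂ)
    (Ψ₂ : Matrix (Fin b) (Fin b) ℂ → Matrix (Fin b) (Fin b) ℂ)
    (hΨ₁ : ∀ ρ : Matrix (Fin a × Fin b) (Fin a × Fin b) ℂ, IsDensity ρ →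
      trSnd (trSnd (U * (ρ ⊗ₖ σ) * Uᴴ)) = Ψ₁ (trSnd ρ))
    (hΨ₂ : ∀ ρ : Matrix (Fin a × Fin b) (Fin a × Fin b) ℂ, IsDensity ρ →
      trFst (trSnd (U * (ρ ⊗ₖ σ) * Uᴴ)) = Ψ₂ (trFst ρ)) :
    ∀ (ρ₁ : Matrix (Fin a) (Fin a) ℂ) (ρ₂ : Matrix (Fin b) (Fin b) ℂ),
      IsDensity ρ₁ → IsDensity ρ₂ →
      vnEntropy (trSnd (trSnd (U * ((ρ₁ ⊗ₖ ρ₂) ⊗ₖ σ) * Uᴴ))) +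
          vnEntropy (trFst (trSnd (U * ((ρ₁ ⊗ₖ ρ₂) ⊗ₖ σ) * Uᴴ))) -
          vnEntropy (trSnd (U * ((ρ₁ ⊗ₖ ρ₂) ⊗ₖ σ) * Uᴴ)) ≥
        (vnEntropy (Ψ₁ ρ₁) - vnEntropy ρ₁) + (vnEntropy (Ψ₂ ρ₂) - vnEntropy ρ₂) -
          (-∑ i, (lam i * (r i : ℝ)) * Real.logb 2 (lam i / (r i : ℝ))) := by
  intro ρ₁ ρ₂ h₁ h₂
  have hρ : IsDensity (ρ₁ ⊗ₖ ρ₂) :=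
    ⟨h₁.1.kronecker h₂.1, by rw [Matrix.trace_kronecker, h₁.2, h₂.2, one_mul]⟩
  have hm1 : trSnd (ρ₁ ⊗ₖ ρ₂) = ρ₁ := by
    ext i j
    have := h₂.2
    simp only [Matrix.trace, Matrix.diag] at this
    simp [trSnd, Matrix.kroneckerMap_apply, ← Finset.mul_sum, this]
  have hm2 : trFst (ρ₁ ⊗ₖ ρ₂) = ρ₂ := by
    ext i j
    have := h₁.2
    simp only [Matrix.trace, Matrix.diag] at this
    simp [trFst, Matrix.kroneckerMap_apply, ← Finset.sum_mul, this]
  rw [hΨ₁ _ hρ, hΨ₂ _ hρ, hm1, hm2]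
  have hd : (Fintype.card (Fin a × Fin b) : ℂ) ≠ 0 := by
    intro h0
    have h0' : Fintype.card (Fin a × Fin b) = 0 := by exact_mod_cast h0
    haveI := Fintype.card_eq_zero_iff.mp h0'
    have := hρ.2
    simp [Matrix.trace] at this
  have hcomm : U * ((1 : Matrix (Fin a × Fin b) (Fin a × Fin b) ℂ) ⊗ₖ σ) =
      ((1 : Matrix (Fin a × Fin b) (Fin a × Fin b) ℂ) ⊗ₖ σ) * U := by
    apply commute_of_fixed U hU σ hσ.1.isHermitian
    have hmix : IsDensity ((Fintype.card (Fin a × Fin b) : ℂ)⁻¹ •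
        (1 : Matrix (Fin a × Fin b) (Fin a × Fin b) ℂ)) := by
      refine ⟨Matrix.PosSemidef.one.smul ?_, ?_⟩
      · have : (0 : ℝ) ≤ ((Fintype.card (Fin a × Fin b) : ℝ))⁻¹ := by positivity
        have h3 := Complex.zero_le_real.mpr this
        rwa [Complex.ofReal_inv, Complex.ofReal_natCast] at h3
      · rw [Matrix.trace_smul, Matrix.trace_one, smul_eq_mul, inv_mul_cancel₀ hd]
    have := hcat _ hmix
    rw [Matrix.smul_kronecker, Matrix.mul_smul, Matrix.smul_mul, trFst_smul] at this
    conv_rhs => rw [← this]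
    rw [smul_smul, mul_inv_cancel₀ hd, one_smul]
  obtain ⟨E₁, μ₁, -, hE₁, hd₁, hp₁, hs₁, hS₁⟩ := herm_diag ρ₁ h₁
  obtain ⟨E₂, μ₂, -, hE₂, hd₂, hp₂, hs₂, hS₂⟩ := herm_diag ρ₂ h₂
  obtain ⟨W, s, -, hW, hdσ, hps, hss, -⟩ := herm_diag σ hσ
  have hb := main_bound U hU (ρ₁ ⊗ₖ ρ₂) (E₁ ⊗ₖ E₂) σ W (fun p => μ₁ p.1 * μ₂ p.2) s
    (by rw [Matrix.conjTranspose_kronecker, ← Matrix.mul_kronecker_mul, hE₁, hE₂]; simp) hW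
    (by
      have : Matrix.diagonal (fun p : Fin a × Fin b => ((μ₁ p.1 * μ₂ p.2 : ℝ) : ℂ)) =
          Matrix.diagonal (fun l => (μ₁ l : ℂ)) ⊗ₖ Matrix.diagonal (fun l => (μ₂ l : ℂ)) := by
        rw [Matrix.diagonal_kronecker_diagonal]; simp
      rw [this, Matrix.conjTranspose_kronecker, ← Matrix.mul_kronecker_mul,
        ← Matrix.mul_kronecker_mul, ← hd₁, ← hd₂])
    hdσ (fun p => mul_nonneg (hp₁ _) (hp₂ _)) hps
    (by
      rw [Fintype.sum_prod_type]
      simp only [← Finset.mul_sum, hs₂, mul_one, hs₁]) hss hcomm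
  have hent : ∑ p : Fin a × Fin b, μ₁ p.1 * μ₂ p.2 * Real.logb 2 (μ₁ p.1 * μ₂ p.2) =
      ∑ i, μ₁ i * Real.logb 2 (μ₁ i) + ∑ i, μ₂ i * Real.logb 2 (μ₂ i) := by
    have : ∀ i j, μ₁ i * μ₂ j * Real.logb 2 (μ₁ i * μ₂ j) =
        μ₁ i * Real.logb 2 (μ₁ i) * μ₂ j + μ₁ i * (μ₂ j * Real.logb 2 (μ₂ j)) := by
      intro i j
      rcases eq_or_ne (μ₁ i) 0 with h0 | h0
      · simp [h0]
      rcases eq_or_ne (μ₂ j) 0 with h1 | h1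
      · simp [h1]
      rw [Real.logb_mul h0 h1]
      ring
    simp only [Fintype.sum_prod_type, this, Finset.sum_add_distrib, ← Finset.mul_sum, hs₂,
      mul_one, ← Finset.sum_mul, hs₁, one_mul]
  have hspec := sum_spec σ W s hW hdσ lam P r hdec (fun i => (hproj i).2) horth hres htr
  have hcard : ∀ i, ((Finset.univ.filter fun m => s m = lam i).card : ℝ) = r i := by
    intro i
    have := hspec (fun x => if x = lam i then 1 else 0)
    rw [Finset.sum_boole] at this
    rw [this, Finset.sum_eq_single i]
    · simp
    · intro j _ hj
      simp [hdist.ne hj]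
    · simp
  have hcat2 := hspec (fun x => x * Real.logb 2
    (x / ((Finset.univ.filter fun m => s m = x).card : ℝ)))
  simp only [hcard] at hcat2
  have hcat3 : ∑ i, (r i : ℝ) * (lam i * Real.logb 2 (lam i / (r i : ℝ))) =
      ∑ i, (lam i * (r i : ℝ)) * Real.logb 2 (lam i / (r i : ℝ)) :=
    Finset.sum_congr rfl fun i _ => by ring
  rw [hcat3] at hcat2
  simp only [hent] at hb
  rw [hcat2] at hb
  rw [hS₁, hS₂]
  linarith
end
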